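/- arXiv:2201.03973 — 3 statements merged into one kernel-verified Lean document; each statement's English description precedes it below -/
import Mathlib

section
/- Let G be a finite simple connected vertex-transitive (q+1)-regular graph with n vertices and m edges, let a ∈ [0,1] and b ∈ ℝ, set η = (1−q)a + b(q+1) and σ = b((1−q)a + bq), and let Ũ be the generalized Grover matrix of G. Then for every real u with |u| small enough that |bu| < 1 and (1 + σu²) − ηuλ > 0 for every eigenvalue λ of P(G), one has det(I_{2m} − u·Ũ)^{1/n} = (1 − b²u²)^{(q−1)/2} · exp[ (1/n) · ∑_{λ ∈ Spec(P(G))} log( (1 + σu²) − ηuλ ) ], the sum being over the n eigenvalues of P(G) counted with multiplicity. -/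
open Matrix BigOperators

/-- The generalized Grover matrix `Ũ` of a graph `G` (real parameters `a`, `b`). -/
noncomputable def gGroverMatrix {V : Type*} [Fintype V] [DecidableEq V] (G : SimpleGraph V)
    [DecidableRel G.Adj] (a b : ℝ) : Matrix G.Dart G.Dart ℝ :=
  fun e f =>
    if f = e.symm then (2 / (G.degree f.snd : ℝ) - 1) * a
    else if f.snd = e.fst then (2 / (G.degree f.snd : ℝ) - 1) * a + b
    else 0

/-- The transition probability matrix of the simple random walk on `G`. -/
noncomputable def transMatrix {V : Type*} [Fintype V] [DecidableEq V] (G : SimpleGraph V)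
    [DecidableRel G.Adj] : Matrix V V ℝ :=
  fun u v => if G.Adj u v then 1 / (G.degree u : ℝ) else 0

namespace SimpleGraph
variable {V : Type*} [Fintype V] [DecidableEq V] (G : SimpleGraph V) [DecidableRel G.Adj]

/-- The arc-reversal matrix of a graph. -/
def dartReversal : Matrix G.Dart G.Dart ℝ := fun e f => if f = e.symm then 1 else 0

/-- The incidence matrix between arcs and their origins. -/
def dartOrigin : Matrix G.Dart V ℝ := fun e v => if e.fst = v then 1 else 0

/-- The incidence matrix between arcs and their terminal vertices. -/
def dartTerminus : Matrix V G.Dart ℝ := fun v f => if f.snd = v then 1 else 0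

theorem dartReversal_mul {α : Type*} (M : Matrix G.Dart α ℝ) (e : G.Dart) (x : α) :
    (G.dartReversal * M) e x = M e.symm x := by
  simp [Matrix.mul_apply, dartReversal]

theorem dartReversal_mul_self : G.dartReversal * G.dartReversal = 1 := by
  ext e f
  rw [dartReversal_mul]
  simp [dartReversal, Matrix.one_apply, eq_comm]

theorem dartTerminus_mul_dartOrigin :
    G.dartTerminus * G.dartOrigin = G.adjMatrix ℝ := by
  ext v w
  simp only [Matrix.mul_apply, dartTerminus, dartOrigin, adjMatrix_apply, ← ite_and,
    ite_mul, one_mul, zero_mul]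
  by_cases h : G.Adj v w
  · rw [Finset.sum_eq_single (⟨(w, v), h.symm⟩ : G.Dart)]
    · simp [h]
    · rintro ⟨⟨x, y⟩, hxy⟩ - hne
      apply if_neg
      rintro ⟨rfl, rfl⟩
      exact hne rfl
    · simp
  · rw [if_neg h]
    refine Finset.sum_eq_zero fun e _ => if_neg ?_
    rintro ⟨rfl, rfl⟩
    exact h e.adj.symm

theorem dartTerminus_mul_dartReversal_mul_dartOrigin {d : ℕ} (hreg : G.IsRegularOfDegree d) :
    G.dartTerminus * (G.dartReversal * G.dartOrigin) = (d : ℝ) • (1 : Matrix V V ℝ) := by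
  ext v w
  rw [Matrix.mul_apply]
  simp only [dartReversal_mul]
  have hs : (∑ f : G.Dart, if f.snd = v then (1 : ℝ) else 0) = d := by
    rw [← Equiv.sum_comp SimpleGraph.Dart.symm_involutive.toPerm]
    simp [← G.dart_fst_fiber_card_eq_degree, ← hreg v]
  by_cases h : v = w
  · subst h
    rw [Matrix.smul_apply, one_apply_eq, smul_eq_mul, mul_one, ← hs]
    refine Finset.sum_congr rfl fun f _ => ?_
    by_cases hf : f.snd = v <;> simp [dartTerminus, dartOrigin, hf]
  · rw [Matrix.smul_apply, one_apply_ne h, smul_zero]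
    refine Finset.sum_eq_zero fun f _ => ?_
    by_cases hf : f.snd = v
    · simp [dartOrigin, hf, h]
    · simp [dartTerminus, hf]

theorem det_smul_one_sub_smul_dartReversal (r s : ℝ) :
    (r • (1 : Matrix G.Dart G.Dart ℝ) - s • G.dartReversal).det =
      (r • (1 : Matrix G.Dart G.Dart ℝ) + s • G.dartReversal).det := by
  let o := Fintype.equivFin V
  let ε : G.Dart → ℝ := fun e => if o e.fst < o e.snd then 1 else -1
  have hsq (e) : ε e * ε e = 1 := by
    simp only [ε]; split_ifs <;> norm_num
  have hsymm (e : G.Dart) : ε e * ε e.symm = -1 := by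
    have : o e.fst ≠ o e.snd := fun h => e.fst_ne_snd (o.injective h)
    rcases lt_or_gt_of_ne this with h | h <;> simp [ε, h, h.not_gt]
  have hD : diagonal ε * diagonal ε = 1 := by
    rw [diagonal_mul_diagonal, ← diagonal_one]; congr 1; ext e; exact hsq e
  have hJ : diagonal ε * G.dartReversal * diagonal ε = -G.dartReversal := by
    ext e f
    rw [mul_diagonal, diagonal_mul, neg_apply]
    by_cases h : f = e.symm
    · subst h
      simp [dartReversal, hsymm]
    · simp [dartReversal, h]
  have : r • (1 : Matrix G.Dart G.Dart ℝ) - s • G.dartReversal =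
      diagonal ε * (r • (1 : Matrix G.Dart G.Dart ℝ) + s • G.dartReversal) * diagonal ε := by
    rw [mul_add, add_mul, mul_smul_comm, mul_smul_comm, smul_mul_assoc, smul_mul_assoc, hJ, mul_one,
      hD, smul_neg, sub_eq_add_neg]
  rw [this, det_mul_right_comm, hD, one_mul]

theorem smul_one_add_mul_smul_one_sub_dartReversal (r s : ℝ) :
    (r • (1 : Matrix G.Dart G.Dart ℝ) + s • G.dartReversal) *
      (r • (1 : Matrix G.Dart G.Dart ℝ) - s • G.dartReversal) =
      (r ^ 2 - s ^ 2) • (1 : Matrix G.Dart G.Dart ℝ) := by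
  simp only [add_mul, mul_sub, smul_mul_assoc, mul_smul_comm, one_mul, mul_one,
    dartReversal_mul_self]
  module

theorem det_one_add_smul_dartReversal {c : ℝ} (hc : |c| < 1) :
    (1 + c • G.dartReversal).det = √(1 - c ^ 2) ^ Fintype.card G.Dart := by
  obtain ⟨hc₁, hc₂⟩ := abs_lt.mp hc
  have hx : √(1 + c) ^ 2 = 1 + c := Real.sq_sqrt (by linarith)
  have hy : √(1 - c) ^ 2 = 1 - c := Real.sq_sqrt (by linarith)
  let r := (√(1 + c) + √(1 - c)) / 2
  let s := (√(1 + c) - √(1 - c)) / 2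
  have hadd : r ^ 2 + s ^ 2 = 1 := by simp only [r, s]; linear_combination (hx + hy) / 2
  have hmul : 2 * (r * s) = c := by simp only [r, s]; linear_combination (hx - hy) / 2
  have hsub : r ^ 2 - s ^ 2 = √(1 - c ^ 2) := by
    rw [show 1 - c ^ 2 = (1 + c) * (1 - c) by ring, Real.sqrt_mul (by linarith)]
    simp only [r, s]; ring
  have hsquare : 1 + c • G.dartReversal =
      (r • (1 : Matrix G.Dart G.Dart ℝ) + s • G.dartReversal) *
        (r • (1 : Matrix G.Dart G.Dart ℝ) + s • G.dartReversal) := by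
    simp only [add_mul, mul_add, smul_mul_assoc, mul_smul_comm, one_mul, mul_one,
      dartReversal_mul_self]
    rw [← hmul]
    nth_rewrite 1 [← one_smul ℝ (1 : Matrix G.Dart G.Dart ℝ), ← hadd]
    module
  rw [hsquare, det_mul]
  nth_rewrite 2 [← det_smul_one_sub_smul_dartReversal]
  rw [← det_mul, smul_one_add_mul_smul_one_sub_dartReversal, det_smul, det_one, mul_one, hsub]

theorem gGroverMatrix_eq {d : ℕ} (hreg : G.IsRegularOfDegree d) (a b : ℝ) :
    gGroverMatrix G a b =
      ((2 / (d : ℝ) - 1) * a + b) • (G.dartOrigin * G.dartTerminus) - b • G.dartReversal := by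
  ext e f
  have hprod : (G.dartOrigin * G.dartTerminus) e f = if f.snd = e.fst then 1 else 0 := by
    simp [Matrix.mul_apply, dartOrigin, dartTerminus, eq_comm]
  rw [Matrix.sub_apply, Matrix.smul_apply, Matrix.smul_apply, hprod, gGroverMatrix, hreg.degree_eq]
  by_cases h : f = e.symm
  · simp [dartReversal, h]
  · simp [dartReversal, h]

/-- An Ihara–Bass type determinant formula for the generalized Grover matrix. -/
theorem det_one_sub_smul_gGroverMatrix {d : ℕ} (hreg : G.IsRegularOfDegree d) (a b : ℝ) {u : ℝ}
    (hbu : |b * u| < 1) :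
    (1 - b ^ 2 * u ^ 2) ^ Fintype.card V * (1 - u • gGroverMatrix G a b).det =
      √(1 - b ^ 2 * u ^ 2) ^ Fintype.card G.Dart *
        ((1 - b ^ 2 * u ^ 2 + u ^ 2 * b * d * ((2 / (d : ℝ) - 1) * a + b)) •
          (1 : Matrix V V ℝ) - (u * ((2 / (d : ℝ) - 1) * a + b)) • G.adjMatrix ℝ).det := by
  set k := (2 / (d : ℝ) - 1) * a + b
  set Y := 1 - b ^ 2 * u ^ 2 with hY
  have hY₀ : Y ≠ 0 := by
    have := (sq_lt_one_iff_abs_lt_one _).mpr hbu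
    rw [hY]; nlinarith
  let R : Matrix G.Dart G.Dart ℝ := 1 - (b * u) • G.dartReversal
  have hR : (1 + (b * u) • G.dartReversal) * R = Y • (1 : Matrix G.Dart G.Dart ℝ) := by
    have := G.smul_one_add_mul_smul_one_sub_dartReversal 1 (b * u)
    simp only [one_smul] at this
    rw [this, hY]
    ring_nf
  have hfactor : 1 - u • gGroverMatrix G a b = (1 + (b * u) • G.dartReversal) *
      (1 - ((u * k / Y) • (R * G.dartOrigin)) * G.dartTerminus) := by
    rw [gGroverMatrix_eq G hreg, mul_sub, mul_one, Matrix.smul_mul, Matrix.mul_smul,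
      Matrix.mul_assoc R, ← Matrix.mul_assoc _ R, hR, Matrix.smul_mul, Matrix.one_mul, smul_smul,
      div_mul_cancel₀ _ hY₀]
    module
  have hvertex : G.dartTerminus * ((u * k / Y) • (R * G.dartOrigin)) =
      (u * k / Y) • (G.adjMatrix ℝ - (b * u * d) • (1 : Matrix V V ℝ)) := by
    simp only [R]
    rw [Matrix.mul_smul, Matrix.sub_mul, Matrix.one_mul, Matrix.smul_mul, Matrix.mul_sub,
      Matrix.mul_smul,
      dartTerminus_mul_dartReversal_mul_dartOrigin G hreg, dartTerminus_mul_dartOrigin, smul_smul]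
  rw [hfactor, det_mul, det_one_add_smul_dartReversal G hbu, det_one_sub_mul_comm, hvertex,
    mul_left_comm, ← det_smul, mul_pow]
  congr 2
  rw [smul_sub, smul_smul, mul_div_cancel₀ _ hY₀]
  module

theorem adjMatrix_eq_smul_transMatrix {d : ℕ} (hd : d ≠ 0) (hreg : G.IsRegularOfDegree d) :
    G.adjMatrix ℝ = (d : ℝ) • transMatrix G := by
  ext v w
  by_cases h : G.Adj v w <;> simp [transMatrix, h, hreg.degree_eq, hd]

theorem isHermitian_transMatrix {d : ℕ} (hreg : G.IsRegularOfDegree d) :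
    (transMatrix G).IsHermitian := by
  ext v w
  simp [transMatrix, hreg.degree_eq, G.adj_comm]

end SimpleGraph

theorem Matrix.det_smul_one_sub_smul_eq_prod_roots {n K : Type*} [Fintype n] [DecidableEq n]
    [Field K] {M : Matrix n n K} (hM : M.charpoly.Splits) (s t : K) :
    (s • (1 : Matrix n n K) - t • M).det = (M.charpoly.roots.map fun x => s - t * x).prod := by
  have hcard : M.charpoly.roots.card = Fintype.card n := by
    rw [← hM.natDegree_eq_card_roots, charpoly_natDegree_eq_dim]
  rcases eq_or_ne t 0 with rfl | ht
  · simp [hcard]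
  have h := hM.eval_eq_prod_roots_of_monic M.charpoly_monic (s / t)
  rw [eval_charpoly] at h
  calc (s • (1 : Matrix n n K) - t • M).det
      = (t • (scalar n (s / t) - M)).det := by
        rw [smul_sub, scalar_apply, ← smul_one_eq_diagonal, smul_smul, mul_div_cancel₀ _ ht]
    _ = _ := by
        rw [det_smul, h, ← hcard, ← Multiset.prod_replicate, ← Multiset.map_const',
          ← Multiset.prod_map_mul]
        simp [mul_sub, mul_div_cancel₀ _ ht]

theorem Real.exp_multiset_sum_log {ι : Type*} (m : Multiset ι) (f : ι → ℝ)
    (hf : ∀ x ∈ m, 0 < f x) : Real.exp (m.map fun x => Real.log (f x)).sum = (m.map f).prod := by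
  rw [Real.exp_multiset_sum, Multiset.map_map]
  exact congrArg _ (Multiset.map_congr rfl fun x hx => Real.exp_log (hf x hx))

/-- **Generalized Grover/Zeta Correspondence** (finite vertex-transitive regular graph,
transition-matrix form).  For small real `u`,
`det(I - u Ũ)^(1/n) = (1 - b²u²)^((q-1)/2) ·
  exp((1/n) ∑_{λ ∈ Spec P} log((1 + σu²) - ηuλ))`,
the sum being over the `n` eigenvalues of `P` (the roots of its characteristic
polynomial) counted with multiplicity. -/
theorem generalized_grover_zeta {V : Type*} [Fintype V] [DecidableEq V] (G : SimpleGraph V)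
    [DecidableRel G.Adj] (hG : G.Connected)
    (hvt : ∀ v w : V, ∃ φ : G ≃g G, φ v = w) (q : ℕ)
    (hreg : G.IsRegularOfDegree (q + 1)) (a b : ℝ) (ha : a ∈ Set.Icc (0 : ℝ) 1)
    (η σ : ℝ) (hη : η = (1 - (q : ℝ)) * a + b * ((q : ℝ) + 1))
    (hσ : σ = b * ((1 - (q : ℝ)) * a + b * (q : ℝ)))
    (u : ℝ) (hbu : |b * u| < 1)
    (hpos : ∀ lam ∈ (transMatrix G).charpoly.roots,
      0 < (1 + σ * u ^ 2) - η * u * lam) :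
    (Matrix.det ((1 : Matrix G.Dart G.Dart ℝ) - u • gGroverMatrix G a b)) ^
        ((1 : ℝ) / (Fintype.card V : ℝ)) =
      (1 - b ^ 2 * u ^ 2) ^ (((q : ℝ) - 1) / 2) *
        Real.exp ((1 / (Fintype.card V : ℝ)) *
          (((transMatrix G).charpoly.roots).map
            (fun lam => Real.log ((1 + σ * u ^ 2) - η * u * lam))).sum) := by
  have := hG.nonempty
  set n := Fintype.card V with hn
  have hn₀ : (n : ℝ) ≠ 0 := Nat.cast_ne_zero.mpr Fintype.card_ne_zero
  set Y := 1 - b ^ 2 * u ^ 2 with hY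
  have hY₀ : 0 < Y := by
    have := (sq_lt_one_iff_abs_lt_one _).mpr hbu
    rw [hY]; nlinarith
  have hdart : Fintype.card G.Dart = n * (q + 1) := by
    simp [G.dart_card_eq_sum_degrees, hreg.degree_eq, hn]
  have hk : ((q + 1 : ℕ) : ℝ) * ((2 / ((q + 1 : ℕ) : ℝ) - 1) * a + b) = η := by
    rw [hη]; field_simp; push_cast; ring
  have hdet := G.det_one_sub_smul_gGroverMatrix hreg a b hbu
  have hs : Y + u ^ 2 * b * ((q + 1 : ℕ) : ℝ) * ((2 / ((q + 1 : ℕ) : ℝ) - 1) * a + b) =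
      1 + σ * u ^ 2 := by
    rw [mul_assoc, hk, hY, hη, hσ]; ring
  have ht : u * ((2 / ((q + 1 : ℕ) : ℝ) - 1) * a + b) * ((q + 1 : ℕ) : ℝ) = η * u := by
    rw [← hk]; ring
  rw [← hY, hs, G.adjMatrix_eq_smul_transMatrix q.succ_ne_zero hreg, smul_smul, ht,
    det_smul_one_sub_smul_eq_prod_roots (G.isHermitian_transMatrix hreg).splits_charpoly,
    ← Real.exp_multiset_sum_log _ _ hpos, hdart] at hdet
  set S := ((transMatrix G).charpoly.roots.map
    fun lam => Real.log ((1 + σ * u ^ 2) - η * u * lam)).sum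
  have hexponent : (((q : ℝ) - 1) / 2) * n + n = 1 / 2 * ((n * (q + 1) : ℕ) : ℝ) := by
    push_cast; ring
  have hroot : (1 - u • gGroverMatrix G a b).det =
      (Y ^ (((q : ℝ) - 1) / 2) * Real.exp (1 / (n : ℝ) * S)) ^ (n : ℝ) := by
    rw [Real.mul_rpow (by positivity) (Real.exp_nonneg _), ← Real.exp_mul, mul_right_comm,
      one_div_mul_cancel hn₀, one_mul, ← Real.rpow_mul hY₀.le]
    refine mul_left_cancel₀ (pow_pos hY₀ n).ne' ?_
    rw [hdet, ← mul_assoc, ← Real.rpow_natCast Y n, ← Real.rpow_add hY₀, add_comm (n : ℝ),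
      hexponent, Real.rpow_mul hY₀.le, Real.rpow_natCast, Real.sqrt_eq_rpow]
  rw [hroot, ← Real.rpow_mul (by positivity), mul_one_div_cancel hn₀, Real.rpow_one]
end

section
/- Let G be a finite simple connected vertex-transitive (q+1)-regular graph with n vertices and m edges, let a ∈ [0,1] and b ∈ ℝ, set η = (1−q)a + b(q+1) and σ = b((1−q)a + bq), let Ũ be the generalized Grover matrix of G, and let Δ = D − A(G) be the Laplacian of G. Then for every real u with |u| small enough that |bu| < 1 and (1 − ηu + σu²) + (ηu/(q+1))λ > 0 for every eigenvalue λ of Δ, one has det(I_{2m} − u·Ũ)^{1/n} = (1 − b²u²)^{(q−1)/2} · exp[ (1/n) · ∑_{λ ∈ Spec(Δ)} log( (1 − ηu + σu²) + (ηu/(q+1))·λ ) ], the sum being over the n eigenvalues of Δ counted with multiplicity. -/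
open Matrix BigOperators

/-- The Laplacian `Δ = D - A` of `G`, as a real matrix. -/
noncomputable def lapMatrixR {V : Type*} [Fintype V] [DecidableEq V] (G : SimpleGraph V)
    [DecidableRel G.Adj] : Matrix V V ℝ :=
  Matrix.diagonal (fun v => (G.degree v : ℝ)) - G.adjMatrix ℝ

/-- The permutation matrix of arc reversal. -/
def dartFlip {V : Type*} [DecidableEq V] (G : SimpleGraph V) : Matrix G.Dart G.Dart ℝ :=
  Matrix.of fun e f => if f = e.symm then 1 else 0

/-- The incidence matrix between arcs and their origins. -/
def dartOrigin {V : Type*} [DecidableEq V] (G : SimpleGraph V) : Matrix G.Dart V ℝ :=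
  Matrix.of fun e v => if e.fst = v then 1 else 0

/-- The incidence matrix between terminal vertices and arcs. -/
def dartTerminus {V : Type*} [DecidableEq V] (G : SimpleGraph V) : Matrix V G.Dart ℝ :=
  Matrix.of fun v e => if e.snd = v then 1 else 0

section DartMatrices

variable {V : Type*} [Fintype V] [DecidableEq V] (G : SimpleGraph V) [DecidableRel G.Adj]

lemma dartFlip_mul_self : dartFlip G * dartFlip G = 1 := by
  ext e f
  have h (d : G.Dart) : f = d.symm ↔ d = f.symm := by
    constructor <;> rintro rfl <;> simp
  simp [dartFlip, Matrix.mul_apply, Matrix.one_apply, h, SimpleGraph.Dart.symm_involutive.injective.eq_iff, eq_comm]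

lemma dartTerminus_mul_dartFlip :
    dartTerminus G * dartFlip G = (dartOrigin G)ᵀ := by
  ext v f
  have h (e : G.Dart) : f = e.symm ↔ e = f.symm := by
    constructor <;> rintro rfl <;> simp
  simp [dartFlip, dartTerminus, dartOrigin, Matrix.mul_apply, h]

lemma dartOrigin_transpose_mul_dartOrigin :
    (dartOrigin G)ᵀ * dartOrigin G = Matrix.diagonal fun v => (G.degree v : ℝ) := by
  ext v w
  simp only [dartOrigin, Matrix.mul_apply, Matrix.transpose_apply, Matrix.of_apply, mul_ite,
    mul_one, mul_zero, ← ite_and, Matrix.diagonal_apply]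
  split_ifs with h
  · subst h
    rw [← G.dart_fst_fiber_card_eq_degree v]
    simp
  · refine Finset.sum_eq_zero fun e _ => if_neg ?_
    rintro ⟨rfl, rfl⟩
    exact h rfl

lemma dartTerminus_mul_dartOrigin : dartTerminus G * dartOrigin G = G.adjMatrix ℝ := by
  ext v w
  simp only [dartTerminus, dartOrigin, Matrix.mul_apply, Matrix.of_apply, mul_ite,
    mul_one, mul_zero, ← ite_and, SimpleGraph.adjMatrix_apply]
  split_ifs with h
  · rw [Finset.sum_eq_single ⟨(w, v), h.symm⟩]
    · simp
    · refine fun e _ he => if_neg ?_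
      rintro ⟨rfl, rfl⟩
      exact he rfl
    · simp
  · refine Finset.sum_eq_zero fun e _ => if_neg ?_
    rintro ⟨rfl, rfl⟩
    exact h e.adj.symm

/-- Conjugating by the signs of an orientation of `G` changes the sign of arc reversal. -/
lemma det_one_sub_smul_dartFlip (β : ℝ) :
    (1 - β • dartFlip G).det = (1 + β • dartFlip G).det := by
  let s : G.Dart → ℝ := fun e =>
    if Fintype.equivFin V e.fst < Fintype.equivFin V e.snd then 1 else -1
  have hs (e : G.Dart) : s e * s e = 1 := by
    simp only [s]; split_ifs <;> norm_num
  have hs' (e : G.Dart) : s e * s e.symm = -1 := by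
    have hne : Fintype.equivFin V e.fst ≠ Fintype.equivFin V e.snd := by
      simp
    simp only [s, SimpleGraph.Dart.symm, Prod.fst_swap, Prod.snd_swap]
    rcases lt_or_gt_of_ne hne with h | h <;> simp [h, h.not_gt]
  have hK : Matrix.diagonal s * Matrix.diagonal s = 1 := by
    simp [Matrix.diagonal_mul_diagonal, hs]
  have hconj : Matrix.diagonal s * dartFlip G * Matrix.diagonal s = -dartFlip G := by
    ext e f
    rw [Matrix.mul_diagonal, Matrix.diagonal_mul, Matrix.neg_apply, dartFlip, Matrix.of_apply]
    split_ifs with h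
    · rw [h, mul_one, hs']
    · simp
  have key : Matrix.diagonal s * (1 + β • dartFlip G) * Matrix.diagonal s =
      1 - β • dartFlip G := by
    rw [mul_add, add_mul, mul_one, hK, Matrix.mul_smul, Matrix.smul_mul, hconj, smul_neg,
      sub_eq_add_neg]
  rw [← key, Matrix.det_mul, Matrix.det_mul, mul_right_comm, ← Matrix.det_mul, hK, Matrix.det_one,
    one_mul]

lemma one_sub_mul_one_add_smul_dartFlip (β : ℝ) :
    (1 - β • dartFlip G) * (1 + β • dartFlip G) = (1 - β ^ 2) • 1 := by
  rw [sub_mul, mul_add, mul_add, Matrix.smul_mul, Matrix.smul_mul, Matrix.mul_smul,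
    Matrix.mul_smul, dartFlip_mul_self, smul_smul, sub_smul]
  simp only [one_mul, mul_one, one_smul, pow_two]
  abel

/-- `1 + β J` is a square of some `x + y J`, so its determinant is nonnegative. -/
lemma det_one_add_smul_dartFlip_nonneg {β : ℝ} (hβ : |β| < 1) :
    0 ≤ (1 + β • dartFlip G).det := by
  obtain ⟨h1, h2⟩ := abs_lt.mp hβ
  set r := √(1 + β)
  set t := √(1 - β)
  have hr : r * r = 1 + β := Real.mul_self_sqrt (by linarith)
  have ht : t * t = 1 - β := Real.mul_self_sqrt (by linarith)
  have hsq : 1 + β • dartFlip G =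
      (((r + t) / 2) • 1 + ((r - t) / 2) • dartFlip G) *
        (((r + t) / 2) • 1 + ((r - t) / 2) • dartFlip G) := by
    simp only [mul_add, add_mul, Matrix.smul_mul, Matrix.mul_smul, dartFlip_mul_self, one_mul,
      mul_one, smul_smul]
    have e1 : (r + t) / 2 * ((r + t) / 2) + (r - t) / 2 * ((r - t) / 2) = 1 := by linarith
    have e2 : (r + t) / 2 * ((r - t) / 2) + (r - t) / 2 * ((r + t) / 2) = β := by linarith
    calc 1 + β • dartFlip G = (1 : ℝ) • 1 + β • dartFlip G := by rw [one_smul]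
      _ = _ := by rw [← e1, ← e2]; simp only [add_smul]; abel
  rw [hsq, Matrix.det_mul]
  exact mul_self_nonneg _

lemma det_one_sub_smul_dartFlip_eq {β : ℝ} (hβ : |β| < 1) :
    (1 - β • dartFlip G).det = (1 - β ^ 2) ^ ((Fintype.card G.Dart : ℝ) / 2) := by
  have h0 : 0 ≤ 1 - β ^ 2 := by
    have := (sq_lt_one_iff_abs_lt_one β).mpr hβ
    linarith
  have h := congrArg Matrix.det (one_sub_mul_one_add_smul_dartFlip G β)
  rw [Matrix.det_mul, det_one_sub_smul_dartFlip, Matrix.det_smul, Matrix.det_one, mul_one] at h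
  rw [det_one_sub_smul_dartFlip, div_eq_mul_inv, Real.rpow_mul h0, Real.rpow_natCast, ← h,
    ← pow_two, ← one_div, ← Real.sqrt_eq_rpow,
    Real.sqrt_sq (det_one_add_smul_dartFlip_nonneg G hβ)]

lemma gGroverMatrix_eq {q : ℕ} (hreg : G.IsRegularOfDegree (q + 1)) (a b : ℝ) :
    gGroverMatrix G a b =
      ((2 / ((q : ℝ) + 1) - 1) * a + b) • (dartOrigin G * dartTerminus G) - b • dartFlip G := by
  ext e f
  simp only [gGroverMatrix, hreg.degree_eq, dartOrigin, dartTerminus, dartFlip, Matrix.sub_apply,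
    Matrix.smul_apply, Matrix.mul_apply, Matrix.of_apply, smul_eq_mul, ite_mul, one_mul, zero_mul,
    Finset.sum_ite_eq, Finset.mem_univ, if_true]
  push_cast
  by_cases h : f = e.symm
  · subst h
    simp
  · simp [h]

end DartMatrices

/-- Weinstein–Aronszajn for `M - S T` when `M` has inverse `t⁻¹ N`. -/
lemma det_mul_det_sub_mul {m n : Type*} [Fintype m] [DecidableEq m] [Fintype n] [DecidableEq n]
    {M N : Matrix m m ℝ} {t : ℝ} (ht : t ≠ 0) (hNM : N * M = t • 1)
    (S : Matrix m n ℝ) (T : Matrix n m ℝ) :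
    N.det * (M - S * T).det * t ^ Fintype.card n =
      t ^ Fintype.card m * (t • 1 - T * N * S).det := by
  have h1 : N * (M - S * T) = t • (1 - (t⁻¹ • (N * S)) * T) := by
    rw [mul_sub, hNM, smul_sub, Matrix.smul_mul, smul_smul, mul_inv_cancel₀ ht, one_smul,
      Matrix.mul_assoc]
  have h2 : t • (1 : Matrix n n ℝ) - T * N * S = t • (1 - T * (t⁻¹ • (N * S))) := by
    rw [smul_sub, Matrix.mul_smul, smul_smul, mul_inv_cancel₀ ht, one_smul, Matrix.mul_assoc]
  rw [← Matrix.det_mul, h1, h2, Matrix.det_smul, Matrix.det_smul, Matrix.det_one_sub_mul_comm]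
  ring

lemma Matrix.IsHermitian.det_smul_one_add_smul {n : Type*} [Fintype n] [DecidableEq n]
    {A : Matrix n n ℝ} (hA : A.IsHermitian) (x y : ℝ) :
    (x • 1 + y • A).det = ∏ i, (x + y * hA.eigenvalues i) := by
  rcases eq_or_ne y 0 with rfl | hy
  · simp
  have h : x • 1 + y • A = (-y) • (Matrix.scalar n (-x / y) - A) := by
    rw [Matrix.scalar_apply, ← Matrix.smul_one_eq_diagonal, smul_sub, smul_smul, neg_mul,
      mul_div_cancel₀ _ hy, neg_neg, neg_smul, sub_neg_eq_add]
  rw [h, Matrix.det_smul, ← Matrix.eval_charpoly, hA.charpoly_eq, Polynomial.eval_prod,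
    Fintype.card, ← Finset.prod_const, ← Finset.prod_mul_distrib]
  refine Finset.prod_congr rfl fun i _ => ?_
  simp
  field_simp
  ring

lemma lapMatrixR_isHermitian {V : Type*} [Fintype V] [DecidableEq V] (G : SimpleGraph V)
    [DecidableRel G.Adj] : (lapMatrixR G).IsHermitian :=
  G.isSymm_lapMatrix ..

/-- **Generalized Grover/Zeta Correspondence** (finite vertex-transitive regular graph,
Laplacian form).  For small real `u`,
`det(I - u Ũ)^(1/n) = (1 - b²u²)^((q-1)/2) ·
  exp((1/n) ∑_{λ ∈ Spec Δ} log((1 - ηu + σu²) + (ηu/(q+1))λ))`,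
the sum being over the `n` eigenvalues of the Laplacian `Δ` (the roots of its
characteristic polynomial) counted with multiplicity. -/
theorem generalized_grover_zeta_laplacian {V : Type*} [Fintype V] [DecidableEq V]
    (G : SimpleGraph V) [DecidableRel G.Adj] (hG : G.Connected)
    (hvt : ∀ v w : V, ∃ φ : G ≃g G, φ v = w) (q : ℕ)
    (hreg : G.IsRegularOfDegree (q + 1)) (a b : ℝ) (ha : a ∈ Set.Icc (0 : ℝ) 1)
    (η σ : ℝ) (hη : η = (1 - (q : ℝ)) * a + b * ((q : ℝ) + 1))
    (hσ : σ = b * ((1 - (q : ℝ)) * a + b * (q : ℝ)))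
    (u : ℝ) (hbu : |b * u| < 1)
    (hpos : ∀ lam ∈ (lapMatrixR G).charpoly.roots,
      0 < (1 - η * u + σ * u ^ 2) + (η * u / ((q : ℝ) + 1)) * lam) :
    (Matrix.det ((1 : Matrix G.Dart G.Dart ℝ) - u • gGroverMatrix G a b)) ^
        ((1 : ℝ) / (Fintype.card V : ℝ)) =
      (1 - b ^ 2 * u ^ 2) ^ (((q : ℝ) - 1) / 2) *
        Real.exp ((1 / (Fintype.card V : ℝ)) *
          (((lapMatrixR G).charpoly.roots).map
            (fun lam => Real.log ((1 - η * u + σ * u ^ 2) +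
              (η * u / ((q : ℝ) + 1)) * lam))).sum) := by
  have : Nonempty V := hG.nonempty
  set n := Fintype.card V with hn
  have hn0 : (n : ℝ) ≠ 0 := by simp [hn]
  have hq : (q : ℝ) + 1 ≠ 0 := by positivity
  set t := 1 - b ^ 2 * u ^ 2 with ht
  set β := u * b with hβ
  have hβ1 : |β| < 1 := by rwa [hβ, mul_comm]
  have htβ : t = 1 - β ^ 2 := by rw [ht, hβ]; ring
  have ht0 : 0 < t := by
    have := (sq_lt_one_iff_abs_lt_one β).mpr hβ1
    linarith
  set k := u * ((2 / ((q : ℝ) + 1) - 1) * a + b) with hk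
  have hkq : k * ((q : ℝ) + 1) = η * u := by
    rw [hk, hη]; field_simp; ring
  have hL := lapMatrixR_isHermitian G
  set p : V → ℝ := fun i =>
    1 - η * u + σ * u ^ 2 + η * u / ((q : ℝ) + 1) * hL.eigenvalues i
  have hroots : (lapMatrixR G).charpoly.roots = Finset.univ.val.map hL.eigenvalues :=
    hL.roots_charpoly_eq_eigenvalues
  have hppos (i : V) : 0 < p i := hpos _ (by rw [hroots]; simp)
  have hM : 1 - u • gGroverMatrix G a b =
      (1 + β • dartFlip G) - (k • dartOrigin G) * dartTerminus G := by
    rw [gGroverMatrix_eq G hreg, smul_sub, smul_smul, smul_smul, Matrix.smul_mul, ← hk, ← hβ]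
    abel
  have hdiag : (Matrix.diagonal fun v => (G.degree v : ℝ)) = ((q : ℝ) + 1) • 1 := by
    ext i j
    simp [hreg.degree_eq, Matrix.diagonal_apply, Matrix.one_apply]
  have hadj : G.adjMatrix ℝ = ((q : ℝ) + 1) • 1 - lapMatrixR G := by
    rw [lapMatrixR, hdiag, sub_sub_cancel]
  have hV : t • (1 : Matrix V V ℝ) - dartTerminus G * (1 - β • dartFlip G) * (k • dartOrigin G) =
      (1 - η * u + σ * u ^ 2) • 1 + (η * u / ((q : ℝ) + 1)) • lapMatrixR G := by
    have hx : t - k * ((q : ℝ) + 1) + k * β * ((q : ℝ) + 1) = 1 - η * u + σ * u ^ 2 := by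
      have : k * β * ((q : ℝ) + 1) = η * u * β := by rw [← hkq]; ring
      rw [this, hkq, ht, hβ, hσ, hη]; ring
    rw [Matrix.mul_smul, Matrix.mul_sub, Matrix.sub_mul, Matrix.mul_one, Matrix.mul_smul, Matrix.smul_mul,
      dartTerminus_mul_dartFlip, dartOrigin_transpose_mul_dartOrigin, dartTerminus_mul_dartOrigin,
      hdiag, hadj, ← hx, ← hkq, mul_div_cancel_right₀ _ hq]
    module
  have hcard : (Fintype.card G.Dart : ℝ) = n * ((q : ℝ) + 1) := by
    rw [G.dart_card_eq_sum_degrees]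
    simp [hreg.degree_eq, hn]
  have hdet : (1 - u • gGroverMatrix G a b).det =
      t ^ ((n : ℝ) * (((q : ℝ) - 1) / 2)) * ∏ i, p i := by
    have h := det_mul_det_sub_mul ht0.ne'
      (htβ ▸ one_sub_mul_one_add_smul_dartFlip G β) (k • dartOrigin G) (dartTerminus G)
    rw [← hM, hV, hL.det_smul_one_add_smul, det_one_sub_smul_dartFlip_eq G hβ1, ← htβ,
      ← Real.rpow_natCast, ← Real.rpow_natCast, hcard, ← hn] at h
    have e : t ^ ((n : ℝ) * ((q : ℝ) + 1)) =
        t ^ ((n : ℝ) * ((q : ℝ) + 1) / 2) * t ^ (n : ℝ) * t ^ ((n : ℝ) * (((q : ℝ) - 1) / 2)) := by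
      rw [← Real.rpow_add ht0, ← Real.rpow_add ht0]
      congr 1
      ring
    have hc : t ^ ((n : ℝ) * ((q : ℝ) + 1) / 2) * t ^ (n : ℝ) ≠ 0 := by positivity
    refine mul_left_cancel₀ hc ?_
    rw [← mul_assoc, ← e, ← h]
    ring
  have hsum : (((lapMatrixR G).charpoly.roots).map (fun lam =>
      Real.log ((1 - η * u + σ * u ^ 2) + (η * u / ((q : ℝ) + 1)) * lam))).sum =
      Real.log (∏ i, p i) := by
    rw [hroots, Multiset.map_map, Real.log_prod fun i _ => (hppos i).ne']
    rfl
  have hprod : 0 < ∏ i, p i := Finset.prod_pos fun i _ => hppos i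
  rw [hsum, hdet, Real.mul_rpow (by positivity) hprod.le, ← Real.rpow_mul ht0.le,
    Real.rpow_def_of_pos hprod, mul_comm (Real.log _)]
  congr 2
  field_simp
end

section
/- Let G be a finite simple connected vertex-transitive graph, let a ∈ [0,1] and b ∈ ℝ, and let Ũ be the generalized Grover matrix of G. Then for every r ≥ 1 and any two vertices v and w of G, ∑_{e ∈ D(G), o(e) = v} (Ũ^r)_{ee} = ∑_{e ∈ D(G), o(e) = w} (Ũ^r)_{ee}; consequently, for every vertex v, ∑_{e ∈ D(G), o(e) = v} (Ũ^r)_{ee} = Tr(Ũ^r) / |V(G)|. (This is the fact underlying the identity ζ_{a,b}(G,u) = Z_{a,b}(G,u)^{1/n} for vertex-transitive graphs.) -/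
open Matrix BigOperators

/-- The permutation of the darts of `G` induced by an automorphism of `G`. -/
def SimpleGraph.Iso.dartPerm {V : Type*} {G : SimpleGraph V} (φ : G ≃g G) :
    Equiv.Perm G.Dart where
  toFun := φ.toHom.mapDart
  invFun := φ.symm.toHom.mapDart
  left_inv e := by ext <;> simp [SimpleGraph.Hom.mapDart]
  right_inv e := by ext <;> simp [SimpleGraph.Hom.mapDart]

@[simp]
theorem SimpleGraph.Iso.dartPerm_fst {V : Type*} {G : SimpleGraph V} (φ : G ≃g G) (e : G.Dart) :
    (φ.dartPerm e).fst = φ e.fst := rfl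

@[simp]
theorem SimpleGraph.Iso.dartPerm_snd {V : Type*} {G : SimpleGraph V} (φ : G ≃g G) (e : G.Dart) :
    (φ.dartPerm e).snd = φ e.snd := rfl

theorem SimpleGraph.Iso.dartPerm_symm_dart {V : Type*} {G : SimpleGraph V} (φ : G ≃g G)
    (e : G.Dart) : (φ.dartPerm e).symm = φ.dartPerm e.symm := rfl

theorem Matrix.submatrix_equiv_pow {n R : Type*} [Fintype n] [DecidableEq n] [Semiring R]
    (A : Matrix n n R) (σ : Equiv.Perm n) (r : ℕ) :
    (A ^ r).submatrix σ σ = A.submatrix σ σ ^ r := by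
  induction r with
  | zero => simp
  | succ r ih => rw [pow_succ, pow_succ, ← ih, Matrix.submatrix_mul_equiv]

/-- Graph automorphisms preserve the generalized Grover matrix. -/
theorem gGroverMatrix_submatrix_dartPerm {V : Type*} [Fintype V] [DecidableEq V]
    (G : SimpleGraph V) [DecidableRel G.Adj] (a b : ℝ) (φ : G ≃g G) :
    (gGroverMatrix G a b).submatrix φ.dartPerm φ.dartPerm = gGroverMatrix G a b := by
  ext e f
  have degree_map : G.degree (φ.dartPerm f).snd = G.degree f.snd := φ.degree_eq _
  simp only [Matrix.submatrix_apply, gGroverMatrix, degree_map]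
  simp [SimpleGraph.Iso.dartPerm_symm_dart]

/-- For a finite simple connected vertex-transitive graph `G`, the partial diagonal
sums of `Ũ^r` over the arcs starting at a fixed vertex do not depend on the vertex,
and each equals `Tr(Ũ^r) / |V(G)|`. -/
theorem gGrover_diag_sum_vertex_transitive {V : Type*} [Fintype V] [DecidableEq V]
    (G : SimpleGraph V) [DecidableRel G.Adj] (hG : G.Connected)
    (hvt : ∀ v w : V, ∃ φ : G ≃g G, φ v = w)
    (a b : ℝ) (ha : a ∈ Set.Icc (0 : ℝ) 1) (r : ℕ) (hr : 1 ≤ r) :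
    (∀ v w : V,
      ∑ e ∈ Finset.univ.filter (fun e : G.Dart => e.fst = v),
        ((gGroverMatrix G a b) ^ r) e e =
      ∑ e ∈ Finset.univ.filter (fun e : G.Dart => e.fst = w),
        ((gGroverMatrix G a b) ^ r) e e) ∧
    (∀ v : V,
      ∑ e ∈ Finset.univ.filter (fun e : G.Dart => e.fst = v),
        ((gGroverMatrix G a b) ^ r) e e =
      Matrix.trace ((gGroverMatrix G a b) ^ r) / (Fintype.card V : ℝ)) := by
  have sum_eq (v w : V) :
      ∑ e ∈ Finset.univ.filter (fun e : G.Dart => e.fst = v), ((gGroverMatrix G a b) ^ r) e e =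
      ∑ e ∈ Finset.univ.filter (fun e : G.Dart => e.fst = w), ((gGroverMatrix G a b) ^ r) e e := by
    obtain ⟨φ, rfl⟩ := hvt v w
    refine Finset.sum_equiv φ.dartPerm (by simp) fun e _ => ?_
    conv_lhs => rw [← gGroverMatrix_submatrix_dartPerm G a b φ, ← Matrix.submatrix_equiv_pow]
    rfl
  refine ⟨sum_eq, fun v => ?_⟩
  have : Nonempty V := ⟨v⟩
  rw [eq_div_iff (by exact_mod_cast Fintype.card_ne_zero), Matrix.trace,
    ← Finset.sum_fiberwise (s := Finset.univ) (g := fun e : G.Dart => e.fst)]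
  simp only [Matrix.diag_apply]
  rw [Finset.sum_congr rfl fun w _ => sum_eq w v, Finset.sum_const, Finset.card_univ,
    nsmul_eq_mul, mul_comm]
end
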